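/- arXiv:1311.7275 — 3 statements merged into one kernel-verified Lean document; each statement's English description precedes it below -/
import Mathlib

section
/- Let A ∈ M_k ⊗ M_k be positive semidefinite with a Hermitian Schmidt decomposition A = Σ_{i=1}^n γ_i ⊗ γ_i (all coefficients equal to 1). Then A admits a Hermitian Schmidt decomposition A = Σ_{i=1}^n γ_i' ⊗ γ_i' in which every γ_i' is positive semidefinite, and this decomposition is unique. -/
open Matrix Kronecker ComplexOrder

section PosSemidef

variable {κ : Type*} [Fintype κ]

open scoped MatrixOrder in
theorem Matrix.PosSemidef.exists_conjTranspose_mul_self {X : Matrix κ κ ℂ}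
    (hX : X.PosSemidef) : ∃ B : Matrix κ κ ℂ, X = Bᴴ * B := by
  classical
  exact CStarAlgebra.nonneg_iff_eq_star_mul_self.mp hX.nonneg

theorem Matrix.PosSemidef.trace_mul_nonneg {X Y : Matrix κ κ ℂ}
    (hX : X.PosSemidef) (hY : Y.PosSemidef) : 0 ≤ (X * Y).trace := by
  obtain ⟨B, rfl⟩ := hY.exists_conjTranspose_mul_self
  rw [← Matrix.mul_assoc, Matrix.trace_mul_comm, ← Matrix.mul_assoc]
  exact (hX.mul_mul_conjTranspose_same B).trace_nonneg

theorem Matrix.PosSemidef.mul_eq_zero_of_trace {X Y : Matrix κ κ ℂ}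
    (hX : X.PosSemidef) (hY : Y.PosSemidef) (h : (X * Y).trace = 0) : X * Y = 0 := by
  obtain ⟨B, rfl⟩ := hY.exists_conjTranspose_mul_self
  obtain ⟨C, rfl⟩ := hX.exists_conjTranspose_mul_self
  have h1 : ((C * Bᴴ)ᴴ * (C * Bᴴ)).trace = 0 := by
    rw [← h, Matrix.conjTranspose_mul, Matrix.conjTranspose_conjTranspose,
      ← Matrix.mul_assoc (Cᴴ * C), Matrix.trace_mul_comm _ B]
    simp only [Matrix.mul_assoc]
  have h2 := Matrix.trace_conjTranspose_mul_self_eq_zero_iff.mp h1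
  calc Cᴴ * C * (Bᴴ * B) = Cᴴ * (C * Bᴴ) * B := by simp only [Matrix.mul_assoc]
    _ = 0 := by simp [h2]

theorem Matrix.IsHermitian.mul_eq_zero_comm {X Y : Matrix κ κ ℂ}
    (hX : X.IsHermitian) (hY : Y.IsHermitian) (h : X * Y = 0) : Y * X = 0 := by
  have := congrArg Matrix.conjTranspose h
  rwa [Matrix.conjTranspose_mul, hX.eq, hY.eq, Matrix.conjTranspose_zero] at this

theorem Matrix.IsHermitian.mul_eq_zero_of_mul_mul {X : Matrix κ κ ℂ} (hX : X.IsHermitian)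
    {B : Matrix κ κ ℂ} (h : X * X * B = 0) : X * B = 0 := by
  rw [← Matrix.conjTranspose_mul_self_mul_eq_zero, hX.eq, h]

theorem Matrix.PosSemidef.mul_eq_zero_of_conj {X : Matrix κ κ ℂ} (hX : X.PosSemidef)
    {B : Matrix κ κ ℂ} (h : Bᴴ * X * B = 0) : X * B = 0 := by
  obtain ⟨C, rfl⟩ := hX.exists_conjTranspose_mul_self
  have h1 : (C * B)ᴴ * (C * B) = 0 := by
    rw [← h, Matrix.conjTranspose_mul]; simp only [Matrix.mul_assoc]
  rw [Matrix.mul_assoc, Matrix.conjTranspose_mul_self_eq_zero.mp h1, Matrix.mul_zero]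

theorem Matrix.PosSemidef.eq_zero_of_neg {X : Matrix κ κ ℂ} (hX : X.PosSemidef)
    (h : (-X).PosSemidef) : X = 0 := by
  rw [← hX.trace_eq_zero_iff]
  have h2 := h.trace_nonneg
  rw [Matrix.trace_neg] at h2
  exact le_antisymm (neg_nonneg.mp h2) hX.trace_nonneg

variable [DecidableEq κ]

theorem Matrix.IsHermitian.exists_diagonalization {Z : Matrix κ κ ℂ} (hZ : Z.IsHermitian) :
    ∃ (U : Matrix κ κ ℂ) (d : κ → ℝ), Uᴴ * U = 1 ∧ U * Uᴴ = 1 ∧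
      Z = U * Matrix.diagonal (fun i => (d i : ℂ)) * Uᴴ := by
  refine ⟨hZ.eigenvectorUnitary, hZ.eigenvalues, ?_, ?_, ?_⟩
  · exact Unitary.coe_star_mul_self hZ.eigenvectorUnitary
  · exact Unitary.coe_mul_star_self hZ.eigenvectorUnitary
  · conv_lhs => rw [hZ.spectral_theorem]
    rfl

theorem Matrix.posSemidef_conj_diagonal (U : Matrix κ κ ℂ) {d : κ → ℝ} (hd : ∀ i, 0 ≤ d i) :
    (U * Matrix.diagonal (fun i => (d i : ℂ)) * Uᴴ).PosSemidef :=
  (Matrix.PosSemidef.diagonal fun i => by simpa using hd i).mul_mul_conjTranspose_same U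

theorem Matrix.conj_diagonal_mul {U : Matrix κ κ ℂ} (hU : Uᴴ * U = 1) (d e : κ → ℂ) :
    (U * Matrix.diagonal d * Uᴴ) * (U * Matrix.diagonal e * Uᴴ) =
      U * Matrix.diagonal (fun i => d i * e i) * Uᴴ := by
  rw [← Matrix.diagonal_mul_diagonal]
  calc _ = U * Matrix.diagonal d * (Uᴴ * U) * Matrix.diagonal e * Uᴴ := by
        simp only [Matrix.mul_assoc]
    _ = _ := by rw [hU]; simp only [Matrix.mul_assoc, Matrix.one_mul]

theorem Matrix.IsHermitian.exists_sub_posSemidef {Z : Matrix κ κ ℂ} (hZ : Z.IsHermitian) :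
    ∃ X Y : Matrix κ κ ℂ, X.PosSemidef ∧ Y.PosSemidef ∧ Z = X - Y ∧ X * Y = 0 := by
  obtain ⟨U, d, hU, -, rfl⟩ := hZ.exists_diagonalization
  refine ⟨_, _, Matrix.posSemidef_conj_diagonal U (d := fun i => max (d i) 0) (by simp),
    Matrix.posSemidef_conj_diagonal U (d := fun i => max (-d i) 0) (by simp), ?_, ?_⟩
  · rw [← Matrix.sub_mul, ← Matrix.mul_sub, Matrix.diagonal_sub]
    congr 3
    ext i
    rcases le_total (d i) 0 with h | h <;> simp [h]
  · rw [Matrix.conj_diagonal_mul hU]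
    have : (fun i => ((max (d i) 0 : ℝ) : ℂ) * ((max (-d i) 0 : ℝ) : ℂ)) = 0 := by
      ext i
      rcases le_total (d i) 0 with h | h <;> simp [h]
    rw [this]; simp

/-- The orthogonal projection `K` onto the kernel of a positive semidefinite matrix. -/
theorem Matrix.PosSemidef.exists_kernel_projection {P : Matrix κ κ ℂ} (hP : P.PosSemidef) :
    ∃ K G : Matrix κ κ ℂ, K.PosSemidef ∧ (1 - K).PosSemidef ∧ K * K = K ∧ P * K = 0 ∧
      1 - K = G * P ∧ 1 - K = P * G := by
  obtain ⟨U, d, hU, hU', rfl⟩ := hP.isHermitian.exists_diagonalization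
  have h1 : (1 : Matrix κ κ ℂ) = U * Matrix.diagonal (fun _ => 1) * Uᴴ := by
    simp [hU']
  have hK : 1 - U * Matrix.diagonal (fun i => ((if d i = 0 then 1 else 0 : ℝ) : ℂ)) * Uᴴ =
      U * Matrix.diagonal (fun i => ((if d i = 0 then 0 else 1 : ℝ) : ℂ)) * Uᴴ := by
    conv_lhs => rw [h1]
    rw [← Matrix.sub_mul, ← Matrix.mul_sub, Matrix.diagonal_sub]
    congr 3
    ext i
    split_ifs <;> simp
  refine ⟨U * Matrix.diagonal (fun i => ((if d i = 0 then 1 else 0 : ℝ) : ℂ)) * Uᴴ,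
    U * Matrix.diagonal (fun i => (((d i)⁻¹ : ℝ) : ℂ)) * Uᴴ,
    Matrix.posSemidef_conj_diagonal U fun i => by positivity, ?_, ?_, ?_, ?_, ?_⟩
  · rw [hK]
    exact Matrix.posSemidef_conj_diagonal U fun i => by positivity
  · rw [Matrix.conj_diagonal_mul hU]
    congr 3
    ext i
    split_ifs <;> simp
  · rw [Matrix.conj_diagonal_mul hU]
    have : (fun i => (d i : ℂ) * ((if d i = 0 then 1 else 0 : ℝ) : ℂ)) = 0 := by
      ext i
      split_ifs with h <;> simp [h]
    rw [this]; simp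
  all_goals
    rw [hK, Matrix.conj_diagonal_mul hU]
    congr 3
    ext i
    split_ifs with h <;> simp [h]

theorem Matrix.PosSemidef.exists_smul_one_sub {Z : Matrix κ κ ℂ} (hZ : Z.PosSemidef) :
    ∃ c : ℂ, (c • (1 : Matrix κ κ ℂ) - Z).PosSemidef := by
  obtain ⟨U, d, hU, hU', rfl⟩ := hZ.isHermitian.exists_diagonalization
  refine ⟨((∑ i, |d i| : ℝ) : ℂ), ?_⟩
  have h1 : ((∑ i, |d i| : ℝ) : ℂ) • (1 : Matrix κ κ ℂ) =
      U * Matrix.diagonal (fun _ => ((∑ i, |d i| : ℝ) : ℂ)) * Uᴴ := by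
    rw [← Matrix.smul_one_eq_diagonal]
    simp [hU']
  rw [h1, ← Matrix.sub_mul, ← Matrix.mul_sub, Matrix.diagonal_sub]
  have h2 : ∀ j, 0 ≤ (∑ i, |d i|) - d j := fun j => by
    have := Finset.single_le_sum (fun i _ => abs_nonneg (d i)) (Finset.mem_univ j)
    linarith [le_abs_self (d j)]
  simpa using Matrix.posSemidef_conj_diagonal U h2

end PosSemidef

section DisjointnessProjection

variable {κ : Type*} [Fintype κ] [DecidableEq κ]

/-- A positive, trace-symmetric idempotent on matrices such that orthogonal positive semidefinite
fixed points `X`, `Y` satisfy `Y * Z * X = 0` for every fixed point `Z`. -/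
structure IsDisjointnessProjection (Φ : Matrix κ κ ℂ →ₗ[ℂ] Matrix κ κ ℂ) : Prop where
  posSemidef : ∀ X, X.PosSemidef → (Φ X).PosSemidef
  trace_symm : ∀ X Y, (Φ X * Y).trace = (X * Φ Y).trace
  idem : ∀ X, Φ (Φ X) = Φ X
  mul_mul_eq_zero : ∀ X Y Z, X.PosSemidef → Y.PosSemidef → Φ X = X → Φ Y = Y → X * Y = 0 →
    Φ Z = Z → Y * Z * X = 0

/-- A normalized positive semidefinite fixed point `E` of `Φ` such that compressing a Hermitian
fixed point to the support of `E` gives a multiple of `E`. -/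
structure IsFixedAtom (Φ : Matrix κ κ ℂ →ₗ[ℂ] Matrix κ κ ℂ) (E : Matrix κ κ ℂ) : Prop where
  posSemidef : E.PosSemidef
  map_eq : Φ E = E
  trace_sq : (E * E).trace = 1
  mul_eq : ∀ Z, Z.IsHermitian → Φ Z = Z → Z * E = (Z * E).trace • (E * E)

namespace IsDisjointnessProjection

variable {Φ : Matrix κ κ ℂ →ₗ[ℂ] Matrix κ κ ℂ}

theorem exists_sub_posSemidef (hΦ : IsDisjointnessProjection Φ)
    {Z : Matrix κ κ ℂ} (hZ : Z.IsHermitian) (hZΦ : Φ Z = Z) :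
    ∃ X Y : Matrix κ κ ℂ, X.PosSemidef ∧ Y.PosSemidef ∧ Φ X = X ∧ Φ Y = Y ∧ Z = X - Y ∧
      X * Y = 0 := by
  obtain ⟨X, Y, hX, hY, rfl, hXY⟩ := hZ.exists_sub_posSemidef
  have hfix : Φ X = X := by
    have h1 : (X * Φ X).trace - (X * Φ Y).trace = (X * X).trace := by
      rw [← Matrix.trace_sub, ← Matrix.mul_sub, ← map_sub, hZΦ, Matrix.mul_sub, hXY, sub_zero]
    have h2 : (Φ X * Φ X).trace = (X * Φ X).trace := by rw [hΦ.trace_symm, hΦ.idem]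
    have h3 := hΦ.trace_symm X X
    have hH : (X - Φ X)ᴴ = X - Φ X := (hX.isHermitian.sub (hΦ.posSemidef X hX).isHermitian).eq
    have h4 : ((X - Φ X)ᴴ * (X - Φ X)).trace = -(X * Φ Y).trace := by
      rw [hH, Matrix.sub_mul, Matrix.mul_sub, Matrix.mul_sub, Matrix.trace_sub, Matrix.trace_sub,
        Matrix.trace_sub, h2, h3, ← h1]
      ring
    have h5 := (Matrix.posSemidef_conjTranspose_mul_self (X - Φ X)).trace_nonneg
    have h6 := hX.trace_mul_nonneg (hΦ.posSemidef Y hY)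
    have h7 : ((X - Φ X)ᴴ * (X - Φ X)).trace = 0 :=
      le_antisymm (h4 ▸ neg_nonpos.mpr h6) h5
    exact (sub_eq_zero.mp (Matrix.trace_conjTranspose_mul_self_eq_zero_iff.mp h7)).symm
  refine ⟨X, Y, hX, hY, hfix, ?_, rfl, hXY⟩
  rw [map_sub, hfix] at hZΦ
  exact sub_right_injective hZΦ

theorem mul_eq_zero_of_map_one (hΦ : IsDisjointnessProjection Φ)
    {Z B : Matrix κ κ ℂ} (hZ : Z.PosSemidef) (hZΦ : Φ Z = Z)
    (hB : Φ 1 * B = 0) : Z * B = 0 := by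
  obtain ⟨c, hc⟩ := hZ.exists_smul_one_sub
  have h1 := hΦ.posSemidef _ hc
  rw [map_sub, map_smul, hZΦ] at h1
  have h2 := h1.conjTranspose_mul_mul_same B
  have h3 : Bᴴ * (c • Φ 1 - Z) * B = -(Bᴴ * Z * B) := by
    rw [Matrix.mul_assoc, Matrix.sub_mul, Matrix.smul_mul, hB]
    simp [Matrix.mul_assoc]
  rw [h3] at h2
  exact hZ.mul_eq_zero_of_conj ((hZ.conjTranspose_mul_mul_same B).eq_zero_of_neg h2)

/-- If `E` is a positive semidefinite fixed point and `K` projects onto its kernel, every positive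
semidefinite fixed point is the sum of one killed by `K` and one killed by `E`. -/
theorem exists_add_of_kernel_projection (hΦ : IsDisjointnessProjection Φ)
    {E K G Z : Matrix κ κ ℂ} (hE : E.PosSemidef)
    (hEΦ : Φ E = E) (hK : K.PosSemidef) (hK' : (1 - K).PosSemidef) (hKK : K * K = K)
    (hEK : E * K = 0) (hG : 1 - K = E * G) (hZ : Z.PosSemidef) (hZΦ : Φ Z = Z) :
    ∃ Z₁ Z₂ : Matrix κ κ ℂ, Z₁.PosSemidef ∧ Φ Z₁ = Z₁ ∧ Z₁ * K = 0 ∧ Z₂ * E = 0 ∧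
      Z = Z₁ + Z₂ := by
  have hN := hΦ.posSemidef K hK
  have hKE : K * E = 0 := hE.isHermitian.mul_eq_zero_comm hK.isHermitian hEK
  have hNE : Φ K * E = 0 := hN.mul_eq_zero_of_trace hE (by
    rw [hΦ.trace_symm, hEΦ, hKE, Matrix.trace_zero])
  have hEN : E * Φ K = 0 := hN.isHermitian.mul_eq_zero_comm hE.isHermitian hNE
  have hNQ : Φ K * (1 - K) = 0 := by rw [hG, ← Matrix.mul_assoc, hNE, Matrix.zero_mul]
  have hQN : (1 - K) * Φ K = 0 := hN.isHermitian.mul_eq_zero_comm hK'.isHermitian hNQ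
  have hQK : Φ (1 - K) * K = 0 := (hΦ.posSemidef _ hK').mul_eq_zero_of_trace hK (by
    rw [hΦ.trace_symm, hQN, Matrix.trace_zero])
  have hNK : Φ K * K = Φ K := by
    rw [Matrix.mul_sub, Matrix.mul_one, sub_eq_zero] at hNQ
    exact hNQ.symm
  have hNZE := hΦ.mul_mul_eq_zero E (Φ K) Z hE hN hEΦ (hΦ.idem K) hEN hZΦ
  have hone : Φ 1 = Φ (1 - K) + Φ K := by rw [← map_add, sub_add_cancel]
  have hoff : K * Z * (1 - K) = 0 := by
    have h1 : Φ 1 * (K * Z * (1 - K)) = 0 := by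
      rw [hone, Matrix.add_mul]
      simp only [← Matrix.mul_assoc, hQK, hNK, Matrix.zero_mul, zero_add]
      rw [hG, ← Matrix.mul_assoc, hNZE, Matrix.zero_mul]
    have h2 := hΦ.mul_eq_zero_of_map_one hZ hZΦ h1
    rw [← Matrix.conjTranspose_mul_self_eq_zero]
    simp only [Matrix.conjTranspose_mul, hK.isHermitian.eq, hK'.isHermitian.eq, hZ.isHermitian.eq]
    calc (1 - K) * (Z * K) * (K * Z * (1 - K))
        = (1 - K) * (Z * ((K * K) * Z * (1 - K))) := by simp only [Matrix.mul_assoc]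
      _ = 0 := by rw [hKK, h2, Matrix.mul_zero]
  have hoff' : (1 - K) * Z * K = 0 := by
    have := congrArg Matrix.conjTranspose hoff
    simpa only [Matrix.conjTranspose_mul, hK.isHermitian.eq, hK'.isHermitian.eq,
      hZ.isHermitian.eq, Matrix.conjTranspose_zero, ← Matrix.mul_assoc] using this
  have hsplit : Z = (1 - K) * Z * (1 - K) + K * Z * K := by
    calc Z = ((1 - K) + K) * Z * ((1 - K) + K) := by
          rw [sub_add_cancel, Matrix.one_mul, Matrix.mul_one]
      _ = ((1 - K) * Z * (1 - K) + K * Z * (1 - K)) + ((1 - K) * Z * K + K * Z * K) := by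
          rw [Matrix.add_mul, Matrix.mul_add, Matrix.add_mul, Matrix.add_mul]
      _ = _ := by rw [hoff, hoff', add_zero, zero_add]
  have hA : ((1 - K) * Z * (1 - K)).PosSemidef := by
    have h := hZ.mul_mul_conjTranspose_same (1 - K)
    rwa [hK'.isHermitian.eq] at h
  have hB : (K * Z * K).PosSemidef := by
    have h := hZ.mul_mul_conjTranspose_same K
    rwa [hK.isHermitian.eq] at h
  refine ⟨Φ ((1 - K) * Z * (1 - K)), Φ (K * Z * K), hΦ.posSemidef _ hA, hΦ.idem _, ?_, ?_, ?_⟩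
  · refine (hΦ.posSemidef _ hA).mul_eq_zero_of_trace hK ?_
    rw [hΦ.trace_symm, Matrix.mul_assoc, hQN, Matrix.mul_zero, Matrix.trace_zero]
  · refine (hΦ.posSemidef _ hB).mul_eq_zero_of_trace hE ?_
    rw [hΦ.trace_symm, hEΦ, Matrix.mul_assoc, hKE, Matrix.mul_zero, Matrix.trace_zero]
  · rw [← map_add, ← hsplit, hZΦ]

/-- If a nonzero Hermitian fixed point annihilates a family `F`, then so does some atom. -/
theorem exists_isFixedAtom (hΦ : IsDisjointnessProjection Φ)
    {ι : Type*} (F : ι → Matrix κ κ ℂ) {Z : Matrix κ κ ℂ}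
    (hZ : Z.IsHermitian) (hZΦ : Φ Z = Z) (hZ0 : Z ≠ 0) (hZF : ∀ j, Z * F j = 0) :
    ∃ E, IsFixedAtom Φ E ∧ ∀ j, E * F j = 0 := by
  let S : Set (Matrix κ κ ℂ) :=
    {X | X.PosSemidef ∧ Φ X = X ∧ X ≠ 0 ∧ ∀ j, X * F j = 0}
  have hS : S.Nonempty := by
    obtain ⟨X, Y, hX, hY, hXΦ, hYΦ, rfl, hXY⟩ := hΦ.exists_sub_posSemidef hZ hZΦ
    have hYX := hX.isHermitian.mul_eq_zero_comm hY.isHermitian hXY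
    by_cases h0 : X = 0
    · refine ⟨Y, hY, hYΦ, ?_, fun j => ?_⟩
      · rintro rfl
        simp [h0] at hZ0
      · simpa [h0] using hZF j
    · refine ⟨X, hX, hXΦ, h0, fun j => hX.isHermitian.mul_eq_zero_of_mul_mul ?_⟩
      have h1 : X * ((X - Y) * F j) = 0 := by rw [hZF, Matrix.mul_zero]
      rwa [← Matrix.mul_assoc, Matrix.mul_sub, hXY, sub_zero] at h1
  obtain ⟨_, ⟨E, ⟨hE, hEΦ, hE0, hEF⟩, rfl⟩, hmax⟩ :=
    (wellFounded_gt (α := Submodule ℂ (κ → ℂ))).has_min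
      ((fun X : Matrix κ κ ℂ => LinearMap.ker X.mulVecLin) '' S) (hS.image _)
  obtain ⟨K, G, hK, hK', hKK, hEK, hG, hG'⟩ := hE.exists_kernel_projection
  have hKF : ∀ j, K * F j = F j := fun j => by
    have h1 : (1 - K) * F j = 0 := by rw [hG, Matrix.mul_assoc, hEF, Matrix.mul_zero]
    rw [Matrix.sub_mul, Matrix.one_mul, sub_eq_zero] at h1
    exact h1.symm
  have hfac : ∀ X : Matrix κ κ ℂ, X * K = 0 → X = X * G * E := fun X hX => by
    rw [Matrix.mul_assoc, ← hG, Matrix.mul_sub, hX, Matrix.mul_one, sub_zero]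
  have hker : ∀ X ∈ S, X * K = 0 → ∀ Y : Matrix κ κ ℂ, X * Y = 0 → E * Y = 0 := by
    intro X hXS hXK Y hXY
    have hle : LinearMap.ker E.mulVecLin ≤ LinearMap.ker X.mulVecLin := by
      intro v hv
      rw [LinearMap.mem_ker, Matrix.mulVecLin_apply] at hv ⊢
      rw [hfac X hXK, ← Matrix.mulVec_mulVec, hv, Matrix.mulVec_zero]
    have heq := eq_of_le_of_not_lt hle (hmax _ ⟨X, hXS, rfl⟩)
    apply Matrix.toLin'.injective
    refine LinearMap.ext fun v => ?_
    have hv : Y.mulVec v ∈ LinearMap.ker X.mulVecLin := by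
      rw [LinearMap.mem_ker, Matrix.mulVecLin_apply, Matrix.mulVec_mulVec, hXY, Matrix.zero_mulVec]
    rw [← heq, LinearMap.mem_ker, Matrix.mulVecLin_apply, Matrix.mulVec_mulVec] at hv
    simpa using hv
  have hzero : ∀ W : Matrix κ κ ℂ, W.IsHermitian → Φ W = W → W * K = 0 → W.trace = 0 → W = 0 := by
    intro W hW hWΦ hWK hWtr
    obtain ⟨X, Y, hX, hY, hXΦ, hYΦ, rfl, hXY⟩ := hΦ.exists_sub_posSemidef hW hWΦ
    have hXK : X * K = 0 := hX.isHermitian.mul_eq_zero_of_mul_mul (by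
      have h1 : X * ((X - Y) * K) = 0 := by rw [hWK, Matrix.mul_zero]
      rwa [← Matrix.mul_assoc, Matrix.mul_sub, hXY, sub_zero] at h1)
    have hYK : Y * K = 0 := by
      rwa [Matrix.sub_mul, hXK, zero_sub, neg_eq_zero] at hWK
    rw [Matrix.trace_sub, sub_eq_zero] at hWtr
    have key : X = 0 ∨ Y = 0 := by
      by_contra! h0
      have hXS : X ∈ S := ⟨hX, hXΦ, h0.1, fun j => by
        rw [← hKF, ← Matrix.mul_assoc, hXK, Matrix.zero_mul]⟩
      have hEY := hker X hXS hXK Y hXY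
      refine h0.2 (Matrix.conjTranspose_mul_self_eq_zero.mp ?_)
      rw [hY.isHermitian.eq]
      nth_rw 1 [hfac Y hYK]
      rw [Matrix.mul_assoc, hEY, Matrix.mul_zero]
    rcases key with rfl | rfl
    · rw [Matrix.trace_zero] at hWtr
      rw [hY.trace_eq_zero_iff.mp hWtr.symm, sub_zero]
    · rw [Matrix.trace_zero] at hWtr
      rw [hX.trace_eq_zero_iff.mp hWtr, sub_zero]
  have htrE : E.trace ≠ 0 := fun h => hE0 (hE.trace_eq_zero_iff.mp h)
  have hpos : ∀ Z : Matrix κ κ ℂ, Z.PosSemidef → Φ Z = Z → ∃ c : ℂ, Z * E = c • (E * E) := by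
    intro Z hZ hZΦ
    obtain ⟨Z₁, Z₂, hZ₁, hZ₁Φ, hZ₁K, hZ₂E, rfl⟩ :=
      hΦ.exists_add_of_kernel_projection hE hEΦ hK hK' hKK hEK hG' hZ hZΦ
    refine ⟨Z₁.trace / E.trace, ?_⟩
    have hreal : star (Z₁.trace / E.trace) = Z₁.trace / E.trace := by
      rw [star_div₀, ← Matrix.trace_conjTranspose, ← Matrix.trace_conjTranspose,
        hZ₁.isHermitian.eq, hE.isHermitian.eq]
    have h1 : Z₁ - (Z₁.trace / E.trace) • E = 0 := by
      apply hzero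
      · rw [Matrix.IsHermitian, Matrix.conjTranspose_sub, Matrix.conjTranspose_smul, hreal,
          hZ₁.isHermitian.eq, hE.isHermitian.eq]
      · rw [map_sub, map_smul, hZ₁Φ, hEΦ]
      · rw [Matrix.sub_mul, hZ₁K, Matrix.smul_mul, hEK, smul_zero, sub_zero]
      · rw [Matrix.trace_sub, Matrix.trace_smul, smul_eq_mul, div_mul_cancel₀ _ htrE, sub_self]
    rw [Matrix.add_mul, hZ₂E, add_zero, sub_eq_zero.mp h1, Matrix.smul_mul]
    simp [htrE]
  have hherm : ∀ Z : Matrix κ κ ℂ, Z.IsHermitian → Φ Z = Z → ∃ c : ℂ, Z * E = c • (E * E) := by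
    intro Z hZ hZΦ
    obtain ⟨X, Y, hX, hY, hXΦ, hYΦ, rfl, -⟩ := hΦ.exists_sub_posSemidef hZ hZΦ
    obtain ⟨a, ha⟩ := hpos X hX hXΦ
    obtain ⟨b, hb⟩ := hpos Y hY hYΦ
    exact ⟨a - b, by rw [Matrix.sub_mul, ha, hb, sub_smul]⟩
  have hEE0 : 0 ≤ (E * E).trace := hE.trace_mul_nonneg hE
  have hEE : (E * E).trace ≠ 0 := fun h => hE0 (by
    have := hE.mul_eq_zero_of_trace hE h
    rwa [← Matrix.conjTranspose_mul_self_eq_zero, hE.isHermitian.eq])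
  obtain ⟨t, ht⟩ : ∃ t : ℝ, (E * E).trace = t := ⟨_, Complex.eq_re_of_ofReal_le hEE0⟩
  have ht0 : 0 < t := lt_of_le_of_ne (by rw [ht] at hEE0; exact_mod_cast hEE0)
    (fun h => hEE (by rw [ht, ← h, Complex.ofReal_zero]))
  have hs : (((√t)⁻¹ : ℝ) : ℂ) * (((√t)⁻¹ : ℝ) : ℂ) * t = 1 := by
    rw [← Complex.ofReal_mul, ← Complex.ofReal_mul, ← mul_inv, Real.mul_self_sqrt ht0.le,
      inv_mul_cancel₀ ht0.ne', Complex.ofReal_one]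
  have hs0 : (((√t)⁻¹ : ℝ) : ℂ) ≠ 0 := by
    intro h
    simp [h] at hs
  have htr : ((((√t)⁻¹ : ℝ) : ℂ) • E * (((√t)⁻¹ : ℝ) : ℂ) • E).trace = 1 := by
    rw [Matrix.smul_mul, Matrix.mul_smul, smul_smul, Matrix.trace_smul, ht, smul_eq_mul, hs]
  refine ⟨(((√t)⁻¹ : ℝ) : ℂ) • E, ⟨?_, ?_, htr, ?_⟩, ?_⟩
  · exact hE.smul (by simp)
  · rw [map_smul, hEΦ]
  · intro W hW hWΦ
    obtain ⟨c, hc⟩ := hherm W hW hWΦ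
    have h1 : W * (((√t)⁻¹ : ℝ) : ℂ) • E = (c / (((√t)⁻¹ : ℝ) : ℂ)) •
        ((((√t)⁻¹ : ℝ) : ℂ) • E * (((√t)⁻¹ : ℝ) : ℂ) • E) := by
      rw [Matrix.mul_smul, hc, Matrix.smul_mul, Matrix.mul_smul, smul_smul, smul_smul, smul_smul]
      congr 1
      field_simp
    rw [h1, Matrix.trace_smul, htr, smul_eq_mul, mul_one]
  · intro j
    rw [Matrix.smul_mul, hEF, smul_zero]

end IsDisjointnessProjection

end DisjointnessProjection

section SchmidtMap

variable {κ ι : Type*} [Fintype κ] [Fintype ι]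

/-- The linear map `Z ↦ ∑ i, tr(γ i * Z) • γ i` attached to `∑ i, γ i ⊗ₖ γ i`. -/
def schmidtMap (γ : ι → Matrix κ κ ℂ) : Matrix κ κ ℂ →ₗ[ℂ] Matrix κ κ ℂ :=
  ∑ i, (Matrix.traceLinearMap κ ℂ ℂ ∘ₗ LinearMap.mulLeft ℂ (γ i)).smulRight (γ i)

theorem schmidtMap_apply (γ : ι → Matrix κ κ ℂ) (Z : Matrix κ κ ℂ) :
    schmidtMap γ Z = ∑ i, (γ i * Z).trace • γ i := by
  simp [schmidtMap]

theorem schmidtMap_apply_apply (γ : ι → Matrix κ κ ℂ) (Z : Matrix κ κ ℂ) (a b : κ) :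
    schmidtMap γ Z a b = ∑ c, ∑ d, (∑ i, γ i ⊗ₖ γ i) (c, a) (d, b) * Z d c := by
  simp only [schmidtMap_apply, Matrix.sum_apply, Matrix.smul_apply, smul_eq_mul, Matrix.trace,
    Matrix.diag, Matrix.mul_apply, Matrix.kroneckerMap_apply, Finset.sum_mul]
  rw [Finset.sum_comm]
  refine Finset.sum_congr rfl fun c _ => ?_
  rw [Finset.sum_comm]
  exact Finset.sum_congr rfl fun d _ => Finset.sum_congr rfl fun i _ => by ring

theorem schmidtMap_congr {ι' : Type*} [Fintype ι'] {γ : ι → Matrix κ κ ℂ}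
    {δ : ι' → Matrix κ κ ℂ} (h : ∑ i, γ i ⊗ₖ γ i = ∑ i, δ i ⊗ₖ δ i) :
    schmidtMap γ = schmidtMap δ := by
  ext Z a b
  rw [schmidtMap_apply_apply, schmidtMap_apply_apply, h]

theorem schmidtMap_self [DecidableEq ι] {γ : ι → Matrix κ κ ℂ}
    (ho : ∀ i j, (γ i * γ j).trace = if i = j then 1 else 0) (j : ι) :
    schmidtMap γ (γ j) = γ j := by
  simp [schmidtMap_apply, ho]

theorem trace_sum_kronecker_mul (γ : ι → Matrix κ κ ℂ) (X Y : Matrix κ κ ℂ) :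
    ((∑ i, γ i ⊗ₖ γ i) * (X ⊗ₖ Y)).trace = (schmidtMap γ X * Y).trace := by
  simp only [Matrix.sum_mul, Matrix.trace_sum, ← Matrix.mul_kronecker_mul,
    Matrix.trace_kronecker, schmidtMap_apply, Matrix.smul_mul, Matrix.trace_smul, smul_eq_mul]

theorem trace_mul_conj_eq_self {X Y : Matrix κ κ ℂ} (hX : X.IsHermitian) (hY : Y.IsHermitian) :
    star (X * Y).trace = (X * Y).trace := by
  rw [← Matrix.trace_conjTranspose, Matrix.conjTranspose_mul, hX.eq, hY.eq, Matrix.trace_mul_comm]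

theorem posSemidef_schmidtMap {γ : ι → Matrix κ κ ℂ} (hA : (∑ i, γ i ⊗ₖ γ i).PosSemidef)
    (hγ : ∀ i, (γ i).IsHermitian) {X : Matrix κ κ ℂ} (hX : X.PosSemidef) :
    (schmidtMap γ X).PosSemidef := by
  classical
  refine Matrix.PosSemidef.of_dotProduct_mulVec_nonneg ?_ fun v => ?_
  · rw [Matrix.IsHermitian, schmidtMap_apply, Matrix.conjTranspose_sum]
    refine Finset.sum_congr rfl fun i _ => ?_
    rw [Matrix.conjTranspose_smul, trace_mul_conj_eq_self (hγ i) hX.isHermitian, (hγ i).eq]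
  · have h := hA.trace_mul_nonneg (hX.kronecker (Matrix.posSemidef_vecMulVec_self_star v))
    rw [trace_sum_kronecker_mul, Matrix.mul_vecMulVec, Matrix.trace_vecMulVec] at h
    rwa [dotProduct_comm]

theorem isDisjointnessProjection_schmidtMap [DecidableEq κ] [DecidableEq ι]
    {γ : ι → Matrix κ κ ℂ} (hA : (∑ i, γ i ⊗ₖ γ i).PosSemidef) (hγ : ∀ i, (γ i).IsHermitian)
    (ho : ∀ i j, (γ i * γ j).trace = if i = j then 1 else 0) :
    IsDisjointnessProjection (schmidtMap γ) where
  posSemidef X hX := posSemidef_schmidtMap hA hγ hX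
  trace_symm X Y := by
    simp only [schmidtMap_apply, Matrix.sum_mul, Matrix.mul_sum, Matrix.trace_sum,
      Matrix.smul_mul, Matrix.mul_smul, Matrix.trace_smul, smul_eq_mul]
    refine Finset.sum_congr rfl fun i _ => ?_
    rw [Matrix.trace_mul_comm X, mul_comm]
  idem X := by
    conv_lhs => rw [schmidtMap_apply γ X, map_sum]
    simp only [map_smul, schmidtMap_self ho, schmidtMap_apply γ X]
  mul_mul_eq_zero X Y Z hX hY hXΦ _ hXY hZ := by
    have h0 : (∑ i, γ i ⊗ₖ γ i) * (X ⊗ₖ Y) = 0 :=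
      hA.mul_eq_zero_of_trace (hX.kronecker hY) (by
        rw [trace_sum_kronecker_mul, hXΦ, hXY, Matrix.trace_zero])
    have h1 : ∑ i, (Y * γ i * X) * (Y * γ i * X)ᴴ = 0 := by
      ext a b
      have h2 : ∀ p q r s, ∑ i, (γ i * X) p q * (γ i * Y) r s = 0 := fun p q r s => by
        have := congrFun (congrFun h0 (p, r)) (q, s)
        simpa only [Matrix.sum_mul, ← Matrix.mul_kronecker_mul, Matrix.sum_apply,
          Matrix.kroneckerMap_apply, Matrix.zero_apply] using this
      have h3 : ∀ i, ((Y * γ i * X) * (Y * γ i * X)ᴴ) a b =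
          ∑ q, ∑ p, ∑ r, Y a p * X q r * ((γ i * X) p q * (γ i * Y) r b) := fun i => by
        have : (Y * γ i * X) * (Y * γ i * X)ᴴ = (Y * (γ i * X)) * (X * (γ i * Y)) := by
          simp only [Matrix.conjTranspose_mul, hX.isHermitian.eq, hY.isHermitian.eq, (hγ i).eq,
            Matrix.mul_assoc]
        rw [this, Matrix.mul_apply]
        refine Finset.sum_congr rfl fun q _ => ?_
        rw [Matrix.mul_apply, Matrix.mul_apply, Finset.sum_mul_sum]
        exact Finset.sum_congr rfl fun p _ => Finset.sum_congr rfl fun r _ => by ring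
      rw [Matrix.sum_apply, Matrix.zero_apply, Finset.sum_congr rfl fun i _ => h3 i,
        Finset.sum_comm]
      refine Finset.sum_eq_zero fun q _ => ?_
      rw [Finset.sum_comm]
      refine Finset.sum_eq_zero fun p _ => ?_
      rw [Finset.sum_comm]
      refine Finset.sum_eq_zero fun r _ => ?_
      rw [← Finset.mul_sum, h2, mul_zero]
    have h4 : ∀ i, Y * γ i * X = 0 := fun i => by
      have h5 := congrArg Matrix.trace h1
      rw [Matrix.trace_sum, Matrix.trace_zero, Finset.sum_eq_zero_iff_of_nonneg fun i _ =>
        (Matrix.posSemidef_self_mul_conjTranspose _).trace_nonneg] at h5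
      exact Matrix.trace_mul_conjTranspose_self_eq_zero_iff.mp (h5 i (Finset.mem_univ i))
    rw [← hZ, schmidtMap_apply, Matrix.mul_sum, Matrix.sum_mul]
    refine Finset.sum_eq_zero fun i _ => ?_
    rw [Matrix.mul_smul, Matrix.smul_mul, h4, smul_zero]

/-- A Hermitian element of the range of `schmidtMap γ` orthogonal to fewer than `n` given
Hermitian matrices. -/
theorem exists_orthogonal_fixed {m n : ℕ} (hmn : m < n) {γ : Fin n → Matrix κ κ ℂ}
    (hγ : ∀ i, (γ i).IsHermitian) (ho : ∀ i j, (γ i * γ j).trace = if i = j then 1 else 0)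
    {E : Fin m → Matrix κ κ ℂ} (hE : ∀ j, (E j).IsHermitian) :
    ∃ Z : Matrix κ κ ℂ, Z.IsHermitian ∧ schmidtMap γ Z = Z ∧ Z ≠ 0 ∧
      ∀ j, (Z * E j).trace = 0 := by
  let M : Matrix (Fin m) (Fin n) ℝ := Matrix.of fun j i => (γ i * E j).trace.re
  have hM : ∀ i j, ((M j i : ℝ) : ℂ) = (γ i * E j).trace := fun i j =>
    Complex.conj_eq_iff_re.mp (trace_mul_conj_eq_self (hγ i) (hE j))
  have hker : LinearMap.ker M.mulVecLin ≠ ⊥ :=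
    M.mulVecLin.ker_ne_bot_of_finrank_lt (by simpa using hmn)
  obtain ⟨c, hc, hc0⟩ := Submodule.exists_mem_ne_zero_of_ne_bot hker
  rw [LinearMap.mem_ker, Matrix.mulVecLin_apply] at hc
  refine ⟨∑ i, (c i : ℂ) • γ i, ?_, ?_, ?_, fun j => ?_⟩
  · rw [Matrix.IsHermitian, Matrix.conjTranspose_sum]
    refine Finset.sum_congr rfl fun i _ => ?_
    rw [Matrix.conjTranspose_smul, (hγ i).eq]
    simp
  · rw [map_sum]
    simp only [map_smul, schmidtMap_self ho]
  · intro h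
    refine hc0 (funext fun i => ?_)
    have h1 : (γ i * ∑ j, (c j : ℂ) • γ j).trace = c i := by
      simp [Matrix.mul_sum, Matrix.trace_sum, ho]
    rw [h, Matrix.mul_zero, Matrix.trace_zero] at h1
    exact_mod_cast h1.symm
  · have h1 : ((M.mulVec c j : ℝ) : ℂ) = 0 := by rw [hc]; simp
    rw [← h1]
    simp only [Matrix.sum_mul, Matrix.trace_sum, Matrix.smul_mul, Matrix.trace_smul, ← hM,
      Matrix.mulVec, dotProduct, smul_eq_mul, Complex.ofReal_sum, Complex.ofReal_mul]
    exact Finset.sum_congr rfl fun i _ => mul_comm _ _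

theorem exists_orthonormal_atoms [DecidableEq κ] {n : ℕ} {γ : Fin n → Matrix κ κ ℂ}
    (hΦ : IsDisjointnessProjection (schmidtMap γ)) (hγ : ∀ i, (γ i).IsHermitian)
    (ho : ∀ i j, (γ i * γ j).trace = if i = j then 1 else 0) (m : ℕ) (hm : m ≤ n) :
    ∃ E : Fin m → Matrix κ κ ℂ, (∀ i, IsFixedAtom (schmidtMap γ) (E i)) ∧
      ∀ i j, (E i * E j).trace = if i = j then 1 else 0 := by
  induction m with
  | zero => exact ⟨Fin.elim0, fun i => i.elim0, fun i => i.elim0⟩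
  | succ m ih =>
    obtain ⟨E, hE, hEo⟩ := ih (by lia)
    obtain ⟨Z, hZ, hZΦ, hZ0, hZE⟩ :=
      exists_orthogonal_fixed hm hγ ho fun j => (hE j).posSemidef.isHermitian
    obtain ⟨F, hF, hFE⟩ := hΦ.exists_isFixedAtom E hZ hZΦ hZ0 fun j => by
      rw [(hE j).mul_eq Z hZ hZΦ, hZE, zero_smul]
    refine ⟨Fin.cons F E, fun i => ?_, fun i j => ?_⟩
    · refine Fin.cases ?_ (fun i => ?_) i
      · simpa using hF
      · simpa using hE i
    · refine Fin.cases ?_ (fun i => ?_) i <;> refine Fin.cases ?_ (fun j => ?_) j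
      · simpa using hF.trace_sq
      · simp [hFE, (Fin.succ_ne_zero j).symm]
      · rw [Matrix.trace_mul_comm]
        simp [hFE, Fin.succ_ne_zero i]
      · simp [hEo]

theorem coefficients_mul_transpose [DecidableEq ι] {γ δ : ι → Matrix κ κ ℂ}
    (hδ : ∀ i, schmidtMap γ (δ i) = δ i)
    (ho : ∀ i j, (δ i * δ j).trace = if i = j then 1 else 0) :
    (Matrix.of fun i j => (γ j * δ i).trace) * (Matrix.of fun i j => (γ j * δ i).trace)ᵀ = 1 := by
  ext i k
  rw [Matrix.one_apply, ← ho, ← hδ k, schmidtMap_apply, Matrix.mul_sum, Matrix.trace_sum,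
    Matrix.mul_apply]
  refine Finset.sum_congr rfl fun j _ => ?_
  rw [Matrix.mul_smul, Matrix.trace_smul, Matrix.trace_mul_comm (δ i), Matrix.transpose_apply,
    Matrix.of_apply, Matrix.of_apply, smul_eq_mul, mul_comm]

theorem sum_kronecker_eq_of_orthonormal [DecidableEq ι] {γ δ : ι → Matrix κ κ ℂ}
    (hδ : ∀ i, schmidtMap γ (δ i) = δ i)
    (ho : ∀ i j, (δ i * δ j).trace = if i = j then 1 else 0) :
    ∑ i, γ i ⊗ₖ γ i = ∑ i, δ i ⊗ₖ δ i := by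
  let U : Matrix ι ι ℂ := Matrix.of fun i j => (γ j * δ i).trace
  have hU : ∀ i, δ i = ∑ j, U i j • γ j := fun i => by
    have h := schmidtMap_apply γ (δ i)
    rw [hδ] at h
    exact h
  have h1 : U * Uᵀ = 1 := coefficients_mul_transpose hδ ho
  have h2 : Uᵀ * U = 1 := mul_eq_one_comm.mp h1
  ext ⟨a, b⟩ ⟨c, d⟩
  simp only [Matrix.sum_apply, Matrix.kroneckerMap_apply]
  have h3 : ∀ i, δ i a c * δ i b d =
      ∑ j, ∑ l, Uᵀ j i * U i l * (γ j a c * γ l b d) := fun i => by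
    rw [hU i, Matrix.sum_apply, Matrix.sum_apply, Finset.sum_mul_sum]
    exact Finset.sum_congr rfl fun j _ => Finset.sum_congr rfl fun l _ => by
      simp only [Matrix.smul_apply, Matrix.transpose_apply, smul_eq_mul]
      ring
  rw [Finset.sum_congr rfl fun i _ => h3 i, Finset.sum_comm]
  refine Finset.sum_congr rfl fun j _ => ?_
  rw [Finset.sum_comm]
  simp_rw [← Finset.sum_mul, ← Matrix.mul_apply, h2, Matrix.one_apply]
  simp

theorem exists_perm_of_nonneg_of_mul_transpose [DecidableEq ι] {C : Matrix ι ι ℂ}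
    (hC : ∀ i j, 0 ≤ C i j) (h : C * Cᵀ = 1) :
    ∃ σ : Equiv.Perm ι, ∀ i j, C i j = if j = σ i then 1 else 0 := by
  have hrow : ∀ i k, ∑ j, C i j * C k j = if i = k then 1 else 0 := fun i k => by
    rw [← Matrix.one_apply, ← h, Matrix.mul_apply]
    rfl
  have hne : ∀ i, ∃ j, C i j ≠ 0 := fun i => by
    by_contra! h0
    simpa [h0] using hrow i i
  choose σ hσ using hne
  have hz : ∀ i k, i ≠ k → C k (σ i) = 0 := fun i k hik => by
    have h1 := hrow i k
    rw [if_neg hik, Finset.sum_eq_zero_iff_of_nonneg fun j _ => mul_nonneg (hC i j) (hC k j)] at h1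
    exact (mul_eq_zero.mp (h1 (σ i) (Finset.mem_univ _))).resolve_left (hσ i)
  have hinj : Function.Injective σ := fun i k hik => by
    by_contra hne
    exact hσ k (hik ▸ hz i k hne)
  have hbij := Finite.injective_iff_bijective.mp hinj
  have hoff : ∀ i j, j ≠ σ i → C i j = 0 := fun i j hj => by
    obtain ⟨k, rfl⟩ := hbij.2 j
    exact hz k i fun hk => hj (hk ▸ rfl)
  refine ⟨Equiv.ofBijective σ hbij, fun i j => ?_⟩
  rw [Equiv.ofBijective_apply]
  split_ifs with hj
  · subst hj
    have h1 := hrow i i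
    rw [if_pos rfl, Finset.sum_eq_single (σ i) (fun j _ hj => by rw [hoff i j hj, mul_zero])
      (fun hj => absurd (Finset.mem_univ _) hj)] at h1
    rcases mul_self_eq_one_iff.mp h1 with h2 | h2
    · exact h2
    · have h3 := hC i (σ i)
      rw [h2] at h3
      norm_num [Complex.le_def] at h3
  · exact hoff i j hj

theorem exists_perm_of_sum_kronecker_eq [DecidableEq ι] {γ δ : ι → Matrix κ κ ℂ}
    (hγ : ∀ i, (γ i).PosSemidef) (hδ : ∀ i, (δ i).PosSemidef)
    (hδo : ∀ i j, (δ i * δ j).trace = if i = j then 1 else 0)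
    (h : ∑ i, γ i ⊗ₖ γ i = ∑ i, δ i ⊗ₖ δ i) :
    ∃ σ : Equiv.Perm ι, ∀ i, δ i = γ (σ i) := by
  classical
  have hfix : ∀ i, schmidtMap γ (δ i) = δ i := fun i => by
    rw [schmidtMap_congr h, schmidtMap_self hδo]
  obtain ⟨σ, hσ⟩ := exists_perm_of_nonneg_of_mul_transpose
    (C := Matrix.of fun i j => (γ j * δ i).trace)
    (fun i j => (hγ j).trace_mul_nonneg (hδ i)) (coefficients_mul_transpose hfix hδo)
  refine ⟨σ, fun i => ?_⟩
  have hσ' : ∀ j, (γ j * δ i).trace = if j = σ i then 1 else 0 := hσ i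
  rw [← hfix i, schmidtMap_apply]
  simp [hσ']

end SchmidtMap

/-- An SPC matrix with all coefficients 1 has a unique Hermitian Schmidt decomposition
`∑ γᵢ' ⊗ γᵢ'` with all `γᵢ'` positive semidefinite. -/
theorem stmt13 {k n : ℕ} (A : Matrix (Fin k × Fin k) (Fin k × Fin k) ℂ)
    (hA : A.PosSemidef)
    (γ : Fin n → Matrix (Fin k) (Fin k) ℂ)
    (hγ : ∀ i, (γ i).IsHermitian)
    (ho : ∀ i j, Matrix.trace (γ i * (γ j)ᴴ) = if i = j then 1 else 0)
    (hdec : A = ∑ i, γ i ⊗ₖ γ i) :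
    ∃ γ' : Fin n → Matrix (Fin k) (Fin k) ℂ,
      (∀ i, (γ' i).PosSemidef) ∧
      (∀ i j, Matrix.trace (γ' i * (γ' j)ᴴ) = if i = j then 1 else 0) ∧
      A = ∑ i, γ' i ⊗ₖ γ' i ∧
      ∀ γ'' : Fin n → Matrix (Fin k) (Fin k) ℂ,
        (∀ i, (γ'' i).PosSemidef) →
        (∀ i j, Matrix.trace (γ'' i * (γ'' j)ᴴ) = if i = j then 1 else 0) →
        A = ∑ i, γ'' i ⊗ₖ γ'' i →
        ∃ σ : Equiv.Perm (Fin n), ∀ i, γ'' i = γ' (σ i) := by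
  have ho' : ∀ i j, (γ i * γ j).trace = if i = j then 1 else 0 := fun i j => by
    rw [← ho, (hγ j).eq]
  subst hdec
  have hΦ := isDisjointnessProjection_schmidtMap hA hγ ho'
  obtain ⟨E, hE, hEo⟩ := exists_orthonormal_atoms hΦ hγ ho' n le_rfl
  have hsum := sum_kronecker_eq_of_orthonormal (fun i => (hE i).map_eq) hEo
  refine ⟨E, fun i => (hE i).posSemidef, fun i j => ?_, hsum, fun δ hδ hδo hδs => ?_⟩
  · rw [(hE j).posSemidef.isHermitian.eq, hEo]
  · refine exists_perm_of_sum_kronecker_eq (fun i => (hE i).posSemidef) hδ (fun i j => ?_)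
      (hsum.symm.trans hδs)
    rw [← hδo, (hδ j).isHermitian.eq]
end

section
/- Every positive semidefinite Hermitian matrix A ∈ M_k ⊗ M_m of tensor rank 2 is PPT, i.e., its partial transpose (transpose applied to the first factor) is also positive semidefinite. -/
open Matrix Kronecker ComplexOrder

/-- The partial transpose (transpose on the first factor), defined entrywise. -/
noncomputable def partialTranspose {k m : ℕ}
    (A : Matrix (Fin k × Fin m) (Fin k × Fin m) ℂ) :
    Matrix (Fin k × Fin m) (Fin k × Fin m) ℂ :=
  Matrix.of fun p q => A (q.1, p.2) (p.1, q.2)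

namespace Matrix

variable {m n : Type*}

lemma IsHermitian.posSemidef_iff_re_nonneg [Fintype n] {M : Matrix n n ℂ} (hM : M.IsHermitian) :
    M.PosSemidef ↔ ∀ v : n → ℂ, 0 ≤ (star v ⬝ᵥ M *ᵥ v).re := by
  refine ⟨fun h v ↦ h.re_dotProduct_nonneg v, fun h ↦ .of_dotProduct_mulVec_nonneg hM fun v ↦ ?_⟩
  exact Complex.nonneg_iff.2 ⟨h v, (hM.im_star_dotProduct_mulVec_self v).symm⟩

lemma IsHermitian.real_smul {M : Matrix n n ℂ} (hM : M.IsHermitian) (x : ℝ) :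
    (x • M).IsHermitian := by
  simp [IsHermitian, conjTranspose_smul, hM.eq]

lemma PosSemidef.real_smul {M : Matrix n n ℂ} (hM : M.PosSemidef) {x : ℝ} (hx : 0 ≤ x) :
    (x • M).PosSemidef :=
  hM.smul hx

lemma PosSemidef.trace_re_pos [Fintype n] {M : Matrix n n ℂ} (hM : M.PosSemidef) (hM0 : M ≠ 0) :
    0 < M.trace.re := by
  have h := Complex.nonneg_iff.1 hM.trace_nonneg
  exact h.1.lt_of_ne fun h0 ↦ hM0 (hM.trace_eq_zero_iff.1 (Complex.ext h0.symm h.2.symm))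

lemma PosSemidef.eq_zero_of_neg_s18 [Fintype n] {M : Matrix n n ℂ} (hM : M.PosSemidef)
    (hM' : (-M).PosSemidef) : M = 0 := by
  by_contra h
  have h₁ := hM.trace_re_pos h
  have h₂ := hM'.trace_re_pos (neg_ne_zero.2 h)
  rw [trace_neg, Complex.neg_re] at h₂
  linarith

/-- A nonzero positive semidefinite matrix can be subtracted from another one, with positive
semidefinite result, up to a largest nonnegative multiple. -/
lemma PosSemidef.exists_isGreatest_sub_smul [Fintype n] {P Q : Matrix n n ℂ} (hP : P.PosSemidef)
    (hQ : Q.PosSemidef) (hQ0 : Q ≠ 0) :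
    ∃ s : ℝ, 0 ≤ s ∧ IsGreatest {x : ℝ | (P - x • Q).PosSemidef} s := by
  have hmem : (0 : ℝ) ∈ {x : ℝ | (P - x • Q).PosSemidef} := by simpa using hP
  have hpos := hQ.trace_re_pos hQ0
  have hbdd : BddAbove {x : ℝ | (P - x • Q).PosSemidef} := by
    refine ⟨P.trace.re / Q.trace.re, fun x hx ↦ ?_⟩
    have h := (Complex.nonneg_iff.1 hx.trace_nonneg).1
    rw [trace_sub, trace_smul, Complex.sub_re, Complex.smul_re, smul_eq_mul] at h
    rw [le_div_iff₀ hpos]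
    linarith
  have hclosed : IsClosed {x : ℝ | (P - x • Q).PosSemidef} := by
    have hset : {x : ℝ | (P - x • Q).PosSemidef} =
        ⋂ v : n → ℂ, {x : ℝ | 0 ≤ (star v ⬝ᵥ P *ᵥ v).re - x * (star v ⬝ᵥ Q *ᵥ v).re} := by
      ext x
      simp [(hP.1.sub (hQ.1.real_smul x)).posSemidef_iff_re_nonneg, sub_mulVec, smul_mulVec]
    rw [hset]
    exact isClosed_iInter fun v ↦ isClosed_le (by fun_prop) (by fun_prop)
  have hgreatest : IsGreatest {x : ℝ | (P - x • Q).PosSemidef} _ :=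
    hclosed.isGreatest_csSup ⟨0, hmem⟩ hbdd
  exact ⟨_, hgreatest.2 hmem, hgreatest⟩

/-- If `a • P + b • Q` is positive semidefinite with `b < 0`, and `s` bounds the multiples of `Q`
that can be subtracted from `P`, then `0 < a` and `0 ≤ s * a + b`. -/
lemma PosSemidef.coeff_of_neg [Fintype n] {P Q : Matrix n n ℂ} (hP : P.PosSemidef)
    (hQ : Q.PosSemidef) (hQ0 : Q ≠ 0) {s : ℝ}
    (hmax : s ∈ upperBounds {x : ℝ | (P - x • Q).PosSemidef}) {a b : ℝ}
    (hab : (a • P + b • Q).PosSemidef) (hb : b < 0) : 0 < a ∧ 0 ≤ s * a + b := by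
  have ha : 0 < a := by
    by_contra! ha
    have h := (Complex.nonneg_iff.1 hab.trace_nonneg).1
    rw [trace_add, trace_smul, trace_smul, Complex.add_re, Complex.smul_re, Complex.smul_re,
      smul_eq_mul, smul_eq_mul] at h
    have h₁ := mul_nonpos_of_nonpos_of_nonneg ha (Complex.nonneg_iff.1 hP.trace_nonneg).1
    have h₂ := mul_neg_of_neg_of_pos hb (hQ.trace_re_pos hQ0)
    linarith
  refine ⟨ha, ?_⟩
  have h : -b / a ≤ s := hmax (by
    rw [Set.mem_ofPred_eq]
    convert hab.real_smul (inv_nonneg.2 ha.le) using 1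
    rw [smul_add, smul_smul, smul_smul, inv_mul_cancel₀ ha.ne', one_smul, sub_eq_add_neg,
      ← neg_smul]
    congr 2
    field_simp)
  rw [div_le_iff₀ ha] at h
  linarith

/-- The cone of pairs `(a, b)` with `a • P + b • Q` positive semidefinite is generated by
`(1, -s)` and `(-t, 1)` for suitable `s, t ≥ 0` with `s * t < 1`. -/
lemma PosSemidef.exists_extreme_pair [Fintype n] {P Q : Matrix n n ℂ} (hP : P.PosSemidef)
    (hQ : Q.PosSemidef) (hQ0 : Q ≠ 0) (hPQ : ∀ s : ℝ, P ≠ s • Q) :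
    ∃ s t : ℝ, s * t < 1 ∧ (P - s • Q).PosSemidef ∧ (Q - t • P).PosSemidef ∧
      ∀ a b : ℝ, (a • P + b • Q).PosSemidef → 0 ≤ a + t * b ∧ 0 ≤ s * a + b := by
  have hP0 : P ≠ 0 := by simpa using hPQ 0
  obtain ⟨s, hs, hsmem, hsmax⟩ := hP.exists_isGreatest_sub_smul hQ hQ0
  obtain ⟨t, ht, htmem, htmax⟩ := hQ.exists_isGreatest_sub_smul hP hP0
  have hst : s * t < 1 := by
    by_contra! h
    refine hPQ s (sub_eq_zero.1 (hsmem.eq_zero_of_neg_s18 ?_))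
    convert (htmem.real_smul hs).add (hP.real_smul (sub_nonneg.2 h)) using 1
    module
  refine ⟨s, t, hst, hsmem, htmem, fun a b hab ↦ ?_⟩
  rcases lt_or_ge b 0 with hb | hb
  · obtain ⟨ha, h⟩ := hP.coeff_of_neg hQ hQ0 hsmax hab hb
    exact ⟨by nlinarith, h⟩
  rcases lt_or_ge a 0 with ha | ha
  · obtain ⟨hb, h⟩ := hQ.coeff_of_neg hP hP0 htmax (by rwa [add_comm]) ha
    exact ⟨by linarith, by nlinarith⟩
  · exact ⟨by positivity, by positivity⟩

lemma eq_zero_of_forall_star_dotProduct_mulVec [Fintype n] {M : Matrix n n ℂ}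
    (h : ∀ v : n → ℂ, star v ⬝ᵥ M *ᵥ v = 0) : M = 0 := by
  classical
  rw [← (toEuclideanLin (𝕜 := ℂ) (m := n) (n := n)).map_eq_zero_iff, ← inner_map_self_eq_zero]
  intro x
  rw [← inner_conj_symm, EuclideanSpace.inner_eq_star_dotProduct]
  simpa [dotProduct_comm] using h x.ofLp

/-- Compressing the second tensor factor to a vector preserves positive semidefiniteness. -/
lemma PosSemidef.compress_right [Fintype m] [Fintype n] {C₁ C₂ : Matrix m m ℂ}
    {D₁ D₂ : Matrix n n ℂ} (h : (C₁ ⊗ₖ D₁ + C₂ ⊗ₖ D₂).PosSemidef) (w : n → ℂ) :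
    ((star w ⬝ᵥ D₁ *ᵥ w) • C₁ + (star w ⬝ᵥ D₂ *ᵥ w) • C₂).PosSemidef := by
  classical
  have h' := (h.conjTranspose_mul_mul_same ((1 : Matrix m m ℂ) ⊗ₖ replicateCol Unit w)).submatrix
    fun i ↦ (i, ())
  convert h' using 1
  rw [conjTranspose_kronecker, Matrix.mul_add, Matrix.add_mul, ← mul_kronecker_mul,
    ← mul_kronecker_mul, ← mul_kronecker_mul, ← mul_kronecker_mul]
  have key (D : Matrix n n ℂ) :
      (replicateRow Unit (star w) * D * replicateCol Unit w) () () = star w ⬝ᵥ D *ᵥ w := by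
    rw [Matrix.mul_assoc]
    rfl
  ext i j
  simp [kroneckerMap_apply, key, mul_comm]

lemma left_coeff_eq_zero_of_not_kronecker {C₁ C₂ : Matrix m m ℂ} {D₁ D₂ : Matrix n n ℂ}
    (h : ¬ ∃ C D, C₁ ⊗ₖ D₁ + C₂ ⊗ₖ D₂ = C ⊗ₖ D) {a b : ℂ} (hab : a • C₁ + b • C₂ = 0) :
    a = 0 ∧ b = 0 := by
  constructor <;> by_contra h0 <;> apply h
  · refine ⟨C₂, D₂ - (b / a) • D₁, ?_⟩
    ext p q
    have := congr_fun₂ hab p.1 q.1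
    simp at this ⊢
    field_simp
    linear_combination D₁ p.2 q.2 * this
  · refine ⟨C₁, D₁ - (a / b) • D₂, ?_⟩
    ext p q
    have := congr_fun₂ hab p.1 q.1
    simp at this ⊢
    field_simp
    linear_combination D₂ p.2 q.2 * this

lemma right_coeff_eq_zero_of_not_kronecker {C₁ C₂ : Matrix m m ℂ} {D₁ D₂ : Matrix n n ℂ}
    (h : ¬ ∃ C D, C₁ ⊗ₖ D₁ + C₂ ⊗ₖ D₂ = C ⊗ₖ D) {a b : ℂ} (hab : a • D₁ + b • D₂ = 0) :
    a = 0 ∧ b = 0 := by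
  constructor <;> by_contra h0 <;> apply h
  · refine ⟨C₂ - (b / a) • C₁, D₂, ?_⟩
    ext p q
    have := congr_fun₂ hab p.2 q.2
    simp at this ⊢
    field_simp
    linear_combination C₁ p.1 q.1 * this
  · refine ⟨C₁ - (a / b) • C₂, D₁, ?_⟩
    ext p q
    have := congr_fun₂ hab p.2 q.2
    simp at this ⊢
    field_simp
    linear_combination C₂ p.1 q.1 * this

/-- A positive semidefinite matrix of tensor rank two has a rank two decomposition whose left
factors are positive semidefinite. -/
lemma PosSemidef.exists_posSemidef_left [Fintype m] [Fintype n] {C₁ C₂ : Matrix m m ℂ}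
    {D₁ D₂ : Matrix n n ℂ} (hA : (C₁ ⊗ₖ D₁ + C₂ ⊗ₖ D₂).PosSemidef)
    (h : ¬ ∃ C D, C₁ ⊗ₖ D₁ + C₂ ⊗ₖ D₂ = C ⊗ₖ D) :
    ∃ (P Q : Matrix m m ℂ) (E F : Matrix n n ℂ), P.PosSemidef ∧ Q.PosSemidef ∧
      C₁ ⊗ₖ D₁ + C₂ ⊗ₖ D₂ = P ⊗ₖ E + Q ⊗ₖ F := by
  obtain ⟨v, hv⟩ : ∃ v : n → ℂ, star v ⬝ᵥ D₁ *ᵥ v ≠ 0 := by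
    by_contra! h0
    have h1 := eq_zero_of_forall_star_dotProduct_mulVec h0
    exact one_ne_zero
      (right_coeff_eq_zero_of_not_kronecker h (a := 1) (b := 0) (by simp [h1])).1
  obtain ⟨w, hw⟩ : ∃ w : n → ℂ, (star v ⬝ᵥ D₁ *ᵥ v) * (star w ⬝ᵥ D₂ *ᵥ w) -
      (star v ⬝ᵥ D₂ *ᵥ v) * (star w ⬝ᵥ D₁ *ᵥ w) ≠ 0 := by
    by_contra! h0
    have h1 : -(star v ⬝ᵥ D₂ *ᵥ v) • D₁ + (star v ⬝ᵥ D₁ *ᵥ v) • D₂ = 0 := by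
      refine eq_zero_of_forall_star_dotProduct_mulVec fun w ↦ ?_
      rw [add_mulVec, smul_mulVec, smul_mulVec, dotProduct_add, dotProduct_smul, dotProduct_smul,
        smul_eq_mul, smul_eq_mul]
      linear_combination h0 w
    exact hv (right_coeff_eq_zero_of_not_kronecker h h1).2
  refine ⟨_, _,
    ((star v ⬝ᵥ D₁ *ᵥ v) * (star w ⬝ᵥ D₂ *ᵥ w) -
      (star v ⬝ᵥ D₂ *ᵥ v) * (star w ⬝ᵥ D₁ *ᵥ w))⁻¹ •
        ((star w ⬝ᵥ D₂ *ᵥ w) • D₁ - (star w ⬝ᵥ D₁ *ᵥ w) • D₂),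
    ((star v ⬝ᵥ D₁ *ᵥ v) * (star w ⬝ᵥ D₂ *ᵥ w) -
      (star v ⬝ᵥ D₂ *ᵥ v) * (star w ⬝ᵥ D₁ *ᵥ w))⁻¹ •
        ((star v ⬝ᵥ D₁ *ᵥ v) • D₂ - (star v ⬝ᵥ D₂ *ᵥ v) • D₁),
    hA.compress_right v, hA.compress_right w, ?_⟩
  generalize star v ⬝ᵥ D₁ *ᵥ v = α₁ at *
  generalize star v ⬝ᵥ D₂ *ᵥ v = α₂ at *
  generalize star w ⬝ᵥ D₁ *ᵥ w = β₁ at *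
  generalize star w ⬝ᵥ D₂ *ᵥ w = β₂ at *
  ext p q
  simp only [add_apply, sub_apply, smul_apply, kroneckerMap_apply, smul_eq_mul]
  field_simp
  ring

lemma IsHermitian.right_of_not_kronecker {P Q : Matrix m m ℂ} {E F : Matrix n n ℂ}
    (hA : (P ⊗ₖ E + Q ⊗ₖ F).IsHermitian) (hP : P.IsHermitian) (hQ : Q.IsHermitian)
    (h : ¬ ∃ C D, P ⊗ₖ E + Q ⊗ₖ F = C ⊗ₖ D) : E.IsHermitian ∧ F.IsHermitian := by
  have key (b c : n) : star (E c b) - E b c = 0 ∧ star (F c b) - F b c = 0 := by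
    refine left_coeff_eq_zero_of_not_kronecker h ?_
    ext i j
    have h₁ := hA.apply (i, b) (j, c)
    simp only [add_apply, kroneckerMap_apply, star_add, star_mul', hP.apply, hQ.apply] at h₁
    simp only [add_apply, smul_apply, smul_eq_mul, zero_apply]
    linear_combination h₁
  exact ⟨IsHermitian.ext fun b c ↦ sub_eq_zero.1 (key b c).1,
    IsHermitian.ext fun b c ↦ sub_eq_zero.1 (key b c).2⟩

/-- A positive semidefinite matrix of tensor rank two is separable. -/
lemma PosSemidef.exists_separable [Fintype m] [Fintype n] {C₁ C₂ : Matrix m m ℂ}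
    {D₁ D₂ : Matrix n n ℂ} (hA : (C₁ ⊗ₖ D₁ + C₂ ⊗ₖ D₂).PosSemidef)
    (h : ¬ ∃ C D, C₁ ⊗ₖ D₁ + C₂ ⊗ₖ D₂ = C ⊗ₖ D) :
    ∃ (X Y : Matrix m m ℂ) (E F : Matrix n n ℂ), X.PosSemidef ∧ Y.PosSemidef ∧
      E.PosSemidef ∧ F.PosSemidef ∧ C₁ ⊗ₖ D₁ + C₂ ⊗ₖ D₂ = X ⊗ₖ E + Y ⊗ₖ F := by
  obtain ⟨P, Q, E, F, hP, hQ, heq⟩ := hA.exists_posSemidef_left h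
  rw [heq] at hA h ⊢
  obtain ⟨hE, hF⟩ := hA.1.right_of_not_kronecker hP.1 hQ.1 h
  have hQ0 : Q ≠ 0 := by
    rintro rfl
    exact h ⟨P, E, by simp⟩
  have hPQ (s : ℝ) : P ≠ s • Q := by
    rintro rfl
    refine h ⟨Q, s • E + F, ?_⟩
    rw [kronecker_add, kronecker_smul, smul_kronecker]
  obtain ⟨s, t, hst, hX, hY, hcone⟩ := hP.exists_extreme_pair hQ hQ0 hPQ
  have hform (w : n → ℂ) : 0 ≤ (star w ⬝ᵥ E *ᵥ w).re + t * (star w ⬝ᵥ F *ᵥ w).re ∧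
      0 ≤ s * (star w ⬝ᵥ E *ᵥ w).re + (star w ⬝ᵥ F *ᵥ w).re := by
    refine hcone _ _ ?_
    have hreal {M : Matrix n n ℂ} (hM : M.IsHermitian) :
        star w ⬝ᵥ M *ᵥ w = ((star w ⬝ᵥ M *ᵥ w).re : ℂ) :=
      Complex.ext rfl (hM.im_star_dotProduct_mulVec_self w)
    have := hA.compress_right w
    rw [hreal hE, hreal hF] at this
    simpa only [Complex.coe_smul] using this
  have hc : 0 ≤ (1 - s * t)⁻¹ := inv_nonneg.2 (by linarith)
  refine ⟨P - s • Q, Q - t • P, (1 - s * t)⁻¹ • (E + t • F), (1 - s * t)⁻¹ • (s • E + F), hX, hY,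
    PosSemidef.real_smul ?_ hc, PosSemidef.real_smul ?_ hc, ?_⟩
  · rw [(hE.add (hF.real_smul t)).posSemidef_iff_re_nonneg]
    intro w
    simpa [add_mulVec, smul_mulVec] using (hform w).1
  · rw [((hE.real_smul s).add hF).posSemidef_iff_re_nonneg]
    intro w
    simpa [add_mulVec, smul_mulVec] using (hform w).2
  · have hne : (1 - s * t : ℂ) ≠ 0 := by exact_mod_cast (sub_pos.2 hst).ne'
    ext p q
    simp only [add_apply, sub_apply, smul_apply, kroneckerMap_apply, Complex.real_smul]
    push_cast
    field_simp
    ring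

end Matrix

lemma partialTranspose_add_kronecker {k m : ℕ} (X Y : Matrix (Fin k) (Fin k) ℂ)
    (E F : Matrix (Fin m) (Fin m) ℂ) :
    partialTranspose (X ⊗ₖ E + Y ⊗ₖ F) = Xᵀ ⊗ₖ E + Yᵀ ⊗ₖ F :=
  rfl

/-- Every positive semidefinite Hermitian matrix of tensor rank 2 is PPT. -/
theorem stmt18 {k m : ℕ} (A : Matrix (Fin k × Fin m) (Fin k × Fin m) ℂ)
    (hA : A.PosSemidef)
    (hrank2 : ∃ (C₁ C₂ : Matrix (Fin k) (Fin k) ℂ) (D₁ D₂ : Matrix (Fin m) (Fin m) ℂ),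
      A = C₁ ⊗ₖ D₁ + C₂ ⊗ₖ D₂)
    (hnot1 : ¬ ∃ (C : Matrix (Fin k) (Fin k) ℂ) (D : Matrix (Fin m) (Fin m) ℂ),
      A = C ⊗ₖ D) :
    (partialTranspose A).PosSemidef := by
  obtain ⟨C₁, C₂, D₁, D₂, rfl⟩ := hrank2
  obtain ⟨X, Y, E, F, hX, hY, hE, hF, heq⟩ := hA.exists_separable hnot1
  rw [heq, partialTranspose_add_kronecker]
  exact (hX.transpose.kronecker hE).add (hY.transpose.kronecker hF)
end

section
/- Every positive semidefinite Hermitian matrix A ∈ M_{k_1} ⊗ ... ⊗ M_{k_n} of tensor rank at most 2 is separable, i.e., A is a finite sum of n-fold Kronecker products of positive semidefinite Hermitian matrices. -/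
open Matrix ComplexOrder

/-- The iterated Kronecker product of a family of matrices, defined entrywise. -/
noncomputable def multiKron {N : ℕ} {k : Fin N → ℕ}
    (A : (i : Fin N) → Matrix (Fin (k i)) (Fin (k i)) ℂ) :
    Matrix ((i : Fin N) → Fin (k i)) ((i : Fin N) → Fin (k i)) ℂ :=
  Matrix.of fun p q => ∏ i, A i (p i) (q i)

open scoped Kronecker

namespace Matrix

section QuadraticForm

variable {m n : Type*} [Fintype m] [Fintype n]

/-- Over `ℂ`, nonnegativity of the quadratic form already forces Hermitian symmetry. -/
theorem PosSemidef.of_forall_nonneg {X : Matrix n n ℂ}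
    (h : ∀ w : n → ℂ, 0 ≤ star w ⬝ᵥ X *ᵥ w) : X.PosSemidef := by
  classical
  rw [← isPositive_toEuclideanLin_iff, LinearMap.isPositive_iff_complex]
  intro x
  have hx : inner ℂ (toEuclideanLin X x) x = star (star x.ofLp ⬝ᵥ X *ᵥ x.ofLp) := by
    rw [EuclideanSpace.inner_eq_star_dotProduct, dotProduct_star, dotProduct_comm]
    rfl
  have h0 : 0 ≤ inner ℂ (toEuclideanLin X x) x := by
    rw [hx]
    exact star_nonneg_iff.2 (h _)
  obtain ⟨hre, him⟩ := RCLike.nonneg_iff.1 h0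
  exact ⟨RCLike.ext (by simp) (by simpa using him.symm), hre⟩

theorem eq_zero_of_quadForm_eq_zero {X : Matrix n n ℂ}
    (h : ∀ w : n → ℂ, star w ⬝ᵥ X *ᵥ w = 0) : X = 0 := by
  classical
  have hX : X.PosSemidef := .of_forall_nonneg fun w => (h w).ge
  rw [← hX.trace_eq_zero_iff]
  refine Finset.sum_eq_zero fun i _ => ?_
  simpa using h (Pi.single i 1)

theorem quadForm_kronecker (A : Matrix m m ℂ) (B : Matrix n n ℂ) (v : m → ℂ) (w : n → ℂ) :
    star (fun p : m × n => v p.1 * w p.2) ⬝ᵥ (A ⊗ₖ B) *ᵥ (fun p : m × n => v p.1 * w p.2) =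
      (star v ⬝ᵥ A *ᵥ v) * (star w ⬝ᵥ B *ᵥ w) := by
  have h : (A ⊗ₖ B) *ᵥ (fun p : m × n => v p.1 * w p.2) =
      fun p => (A *ᵥ v) p.1 * (B *ᵥ w) p.2 := by
    ext p
    simp only [mulVec, dotProduct, kroneckerMap_apply, Fintype.sum_prod_type,
      Finset.sum_mul_sum]
    exact Finset.sum_congr rfl fun _ _ => Finset.sum_congr rfl fun _ _ => by ring
  rw [h]
  simp only [dotProduct, Fintype.sum_prod_type, Finset.sum_mul_sum, Pi.star_apply, star_mul']
  exact Finset.sum_congr rfl fun _ _ => Finset.sum_congr rfl fun _ _ => by ring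

theorem PosSemidef.slice {A C : Matrix m m ℂ} {B D : Matrix n n ℂ}
    (h : (A ⊗ₖ B + C ⊗ₖ D).PosSemidef) (w : n → ℂ) :
    ((star w ⬝ᵥ B *ᵥ w) • A + (star w ⬝ᵥ D *ᵥ w) • C).PosSemidef := by
  refine .of_forall_nonneg fun v => ?_
  have hv := h.dotProduct_mulVec_nonneg (fun p : m × n => v p.1 * w p.2)
  rw [add_mulVec, dotProduct_add, quadForm_kronecker, quadForm_kronecker] at hv
  simpa [add_mulVec, dotProduct_add, smul_mulVec, mul_comm] using hv

omit [Fintype m] in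
theorem eq_zero_of_slice_eq_zero {Z : Matrix (m × n) (m × n) ℂ}
    (h : ∀ i j (w : n → ℂ), star w ⬝ᵥ (of fun p q => Z (i, p) (j, q)) *ᵥ w = 0) : Z = 0 := by
  ext ⟨i, p⟩ ⟨j, q⟩
  exact congrFun₂ (eq_zero_of_quadForm_eq_zero (h i j)) p q

/-- Moving in a nonzero traceless Hermitian direction leaves the positive semidefinite cone. -/
theorem bddAbove_setOf_posSemidef_add_smul (T : Matrix m m ℂ) {D : Matrix m m ℂ}
    (hD : D.IsHermitian) (hD0 : D ≠ 0) (hDtr : D.trace = 0) :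
    BddAbove {t : ℝ | (T + (t : ℂ) • D).PosSemidef} := by
  have hnot : ¬ D.PosSemidef := fun h => hD0 (h.trace_eq_zero_iff.1 hDtr)
  have : ∃ v : m → ℂ, (star v ⬝ᵥ D *ᵥ v).re < 0 := by
    by_contra! hv
    refine hnot (.of_dotProduct_mulVec_nonneg hD fun v => ?_)
    exact RCLike.nonneg_iff.2 ⟨hv v, hD.im_star_dotProduct_mulVec_self v⟩
  obtain ⟨v, hv⟩ := this
  refine ⟨(star v ⬝ᵥ T *ᵥ v).re / -(star v ⬝ᵥ D *ᵥ v).re, fun t ht => ?_⟩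
  have h := (RCLike.nonneg_iff.1 (ht.dotProduct_mulVec_nonneg v)).1
  simp only [add_mulVec, smul_mulVec, dotProduct_add, dotProduct_smul, smul_eq_mul,
    RCLike.re_to_complex, Complex.add_re, Complex.re_ofReal_mul] at h
  rw [le_div_iff₀ (by linarith)]
  linarith

theorem isClosed_setOf_posSemidef_add_smul (T D : Matrix m m ℂ) :
    IsClosed {t : ℝ | (T + (t : ℂ) • D).PosSemidef} := by
  have h : {t : ℝ | (T + (t : ℂ) • D).PosSemidef} =
      ⋂ v : m → ℂ, {t : ℝ | 0 ≤ star v ⬝ᵥ T *ᵥ v + (t : ℂ) * (star v ⬝ᵥ D *ᵥ v)} := by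
    ext t
    simp only [Set.mem_iInter, Set.mem_ofPred_eq]
    refine ⟨fun h v => ?_, fun h => .of_forall_nonneg fun v => ?_⟩
    · simpa [add_mulVec, dotProduct_add, smul_mulVec] using h.dotProduct_mulVec_nonneg v
    · simpa [add_mulVec, dotProduct_add, smul_mulVec] using h v
  rw [h]
  exact isClosed_iInter fun v => isClosed_le continuous_const (by fun_prop)

/-- A two-dimensional slice of the positive semidefinite cone is generated by two rays. -/
theorem exists_generators_posSemidef {T D : Matrix m m ℂ} (hT : T.PosSemidef)
    (hD : D.IsHermitian) (hT0 : T.trace ≠ 0) (hD0 : D ≠ 0) (hDtr : D.trace = 0)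
    (hTD : (T + D).PosSemidef) :
    ∃ s t : ℝ, s < t ∧ (T + (s : ℂ) • D).PosSemidef ∧ (T + (t : ℂ) • D).PosSemidef ∧
      ∀ x y : ℂ, (x • T + y • D).PosSemidef → 0 ≤ y - s * x ∧ 0 ≤ t * x - y := by
  set S : Set ℝ := {t : ℝ | (T + (t : ℂ) • D).PosSemidef} with hS
  have hup : BddAbove S := bddAbove_setOf_posSemidef_add_smul T hD hD0 hDtr
  have hlow : BddBelow S := by
    obtain ⟨b, hb⟩ := bddAbove_setOf_posSemidef_add_smul T hD.neg (neg_ne_zero.2 hD0)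
      (by rw [trace_neg, hDtr, neg_zero])
    refine ⟨-b, fun t ht => neg_le.1 (hb ?_)⟩
    simpa [hS] using ht
  have hcl : IsClosed S := isClosed_setOf_posSemidef_add_smul T D
  have h0 : (0 : ℝ) ∈ S := by simpa [hS] using hT
  have h1 : (1 : ℝ) ∈ S := by simpa [hS] using hTD
  refine ⟨sInf S, sSup S, ?_, hcl.csInf_mem ⟨0, h0⟩ hlow, hcl.csSup_mem ⟨0, h0⟩ hup,
    fun x y hxy => ?_⟩
  · linarith [csInf_le hlow h0, le_csSup hup h1]
  have hTpos : 0 < T.trace := lt_of_le_of_ne hT.trace_nonneg hT0.symm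
  have hx : 0 ≤ x := by
    have := hxy.trace_nonneg
    rw [trace_add, trace_smul, trace_smul, hDtr, smul_zero, add_zero, smul_eq_mul] at this
    simpa [mul_assoc, mul_inv_cancel₀ hT0] using mul_nonneg this (inv_nonneg.2 hTpos.le)
  rcases hx.eq_or_lt with rfl | hx
  · have hy : y = 0 := by
      rw [zero_smul, zero_add] at hxy
      have := hxy.trace_eq_zero_iff.1 (by rw [trace_smul, hDtr, smul_zero])
      exact (smul_eq_zero.1 this).resolve_right hD0
    simp [hy]
  have hyD : (y • D).IsHermitian := by
    have := hxy.isHermitian.sub (hT.smul hx.le).isHermitian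
    rwa [add_sub_cancel_left] at this
  have hy : star y = y := by
    rw [IsHermitian, conjTranspose_smul, hD.eq] at hyD
    exact smul_left_injective ℂ hD0 hyD
  obtain ⟨u, rfl⟩ := Complex.conj_eq_iff_real.1 hy
  obtain ⟨r, hr, rfl⟩ : ∃ r : ℝ, 0 < r ∧ (r : ℂ) = x := RCLike.pos_iff_exists_ofReal.1 hx
  have hmem : u / r ∈ S := by
    have hne : (r : ℂ) ≠ 0 := by exact_mod_cast hr.ne'
    have := hxy.smul (a := (r : ℂ)⁻¹) (inv_nonneg.2 hx.le)
    rw [smul_add, smul_smul, smul_smul, inv_mul_cancel₀ hne, one_smul] at this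
    rw [← div_eq_inv_mul, ← Complex.ofReal_div] at this
    exact this
  have hl := csInf_le hlow hmem
  have hu := le_csSup hup hmem
  rw [le_div_iff₀ hr] at hl
  rw [div_le_iff₀ hr] at hu
  constructor
  · exact_mod_cast sub_nonneg.2 hl
  · exact_mod_cast sub_nonneg.2 hu

omit [Fintype m] in
theorem kronecker_add_kronecker_eq_of_slice {A C T : Matrix m m ℂ} {B D K : Matrix n n ℂ}
    (h : ∀ w : n → ℂ, (star w ⬝ᵥ B *ᵥ w) • A + (star w ⬝ᵥ D *ᵥ w) • C =
      (star w ⬝ᵥ K *ᵥ w) • T) :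
    A ⊗ₖ B + C ⊗ₖ D = T ⊗ₖ K := by
  rw [← sub_eq_zero]
  refine eq_zero_of_slice_eq_zero fun i j w => ?_
  have hZ : (of fun p q => (A ⊗ₖ B + C ⊗ₖ D - T ⊗ₖ K) (i, p) (j, q)) =
      A i j • B + C i j • D - T i j • K := by
    ext p q
    simp
  have hij := congrFun₂ (h w) i j
  simp only [add_apply, smul_apply, smul_eq_mul] at hij
  simp only [hZ, sub_mulVec, add_mulVec, smul_mulVec, dotProduct_sub, dotProduct_add,
    dotProduct_smul, smul_eq_mul]
  linear_combination hij

/-- A positive semidefinite matrix of operator Schmidt rank at most two is separable, with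
right factors in the span of the given ones. -/
theorem PosSemidef.exists_kronecker_add_kronecker {A C : Matrix m m ℂ} {B D : Matrix n n ℂ}
    (h : (A ⊗ₖ B + C ⊗ₖ D).PosSemidef) :
    ∃ (P Q : Matrix m m ℂ) (a b c d : ℂ), P.PosSemidef ∧ Q.PosSemidef ∧
      (a • B + b • D).PosSemidef ∧ (c • B + d • D).PosSemidef ∧
      A ⊗ₖ B + C ⊗ₖ D = P ⊗ₖ (a • B + b • D) + Q ⊗ₖ (c • B + d • D) := by
  set S : (n → ℂ) → Matrix m m ℂ := fun w =>
    (star w ⬝ᵥ B *ᵥ w) • A + (star w ⬝ᵥ D *ᵥ w) • C with hS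
  have hSpos : ∀ w, (S w).PosSemidef := h.slice
  by_cases hzero : ∀ w, S w = 0
  · refine ⟨0, 0, 0, 0, 0, 0, .zero, .zero, by simpa using .zero, by simpa using .zero, ?_⟩
    rw [kronecker_add_kronecker_eq_of_slice (T := 0) (K := 0) (by simpa using hzero)]
    simp
  push Not at hzero
  obtain ⟨w₀, hw₀⟩ := hzero
  have htr : (S w₀).trace ≠ 0 := fun h0 => hw₀ ((hSpos w₀).trace_eq_zero_iff.1 h0)
  have htr_nonneg : ∀ w, 0 ≤ (S w).trace := fun w => (hSpos w).trace_nonneg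
  by_cases hline : ∀ w, S w = ((S w).trace / (S w₀).trace) • S w₀
  · have hq : ∀ w : n → ℂ, star w ⬝ᵥ ((A.trace / (S w₀).trace) • B +
        (C.trace / (S w₀).trace) • D) *ᵥ w = (S w).trace / (S w₀).trace := by
      intro w
      simp only [hS, add_mulVec, smul_mulVec, dotProduct_add, dotProduct_smul, smul_eq_mul,
        trace_add, trace_smul]
      ring
    refine ⟨S w₀, 0, A.trace / (S w₀).trace, C.trace / (S w₀).trace, 0, 0, hSpos w₀, .zero,
      .of_forall_nonneg fun w => ?_, by simpa using .zero, ?_⟩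
    · rw [hq]
      exact div_nonneg (htr_nonneg w) (htr_nonneg w₀)
    · rw [zero_kronecker, add_zero]
      refine kronecker_add_kronecker_eq_of_slice fun w => ?_
      rw [hq, ← hline]
  push Not at hline
  obtain ⟨w₁, hw₁⟩ := hline
  have htr₁ : (S w₁).trace ≠ 0 := fun h0 => hw₁ (by
    rw [h0, zero_div, zero_smul, (hSpos w₁).trace_eq_zero_iff.1 h0])
  set c := (S w₀).trace / (S w₁).trace with hc
  set E : Matrix m m ℂ := c • S w₁ - S w₀ with hE
  have hcS : (c • S w₁).PosSemidef := (hSpos w₁).smul (div_nonneg (htr_nonneg _) (htr_nonneg _))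
  have hE0 : E ≠ 0 := fun h0 => hw₁ (by
    have hratio : (S w₁).trace / (S w₀).trace * c = 1 := by rw [hc]; field_simp
    rw [hE, sub_eq_zero] at h0
    calc S w₁ = ((S w₁).trace / (S w₀).trace) • (c • S w₁) := by
          rw [smul_smul, hratio, one_smul]
      _ = _ := by rw [h0])
  have hEtr : E.trace = 0 := by
    rw [hE, trace_sub, trace_smul, smul_eq_mul, hc, div_mul_cancel₀ _ htr₁, sub_self]
  obtain ⟨s, t, hst, hs, ht, hcone⟩ := exists_generators_posSemidef (hSpos w₀)
    (hcS.isHermitian.sub (hSpos w₀).isHermitian) htr hE0 hEtr (by simpa [hE] using hcS)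
  obtain ⟨α, β, hT⟩ : ∃ α β : ℂ, S w₀ = α • A + β • C := ⟨_, _, rfl⟩
  obtain ⟨γ, δ, hEA⟩ : ∃ γ δ : ℂ, E = γ • A + δ • C := by
    refine ⟨c * (star w₁ ⬝ᵥ B *ᵥ w₁) - star w₀ ⬝ᵥ B *ᵥ w₀,
      c * (star w₁ ⬝ᵥ D *ᵥ w₁) - star w₀ ⬝ᵥ D *ᵥ w₀, ?_⟩
    simp only [hE, hS]
    module
  have hindep : ∀ x y : ℂ, x • S w₀ + y • E = 0 → x = 0 ∧ y = 0 := by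
    intro x y hxy
    have hx : x = 0 := by
      have := congrArg trace hxy
      rw [trace_add, trace_smul, trace_smul, hEtr, smul_zero, add_zero, trace_zero] at this
      exact (smul_eq_zero.1 this).resolve_right htr
    rw [hx, zero_smul, zero_add] at hxy
    exact ⟨hx, (smul_eq_zero.1 hxy).resolve_right hE0⟩
  have hdet : α * δ - β * γ ≠ 0 := by
    intro h0
    obtain ⟨hδ, hβ⟩ := hindep δ (-β) (by
      have : δ • S w₀ + (-β) • E = (α * δ - β * γ) • A := by rw [hT, hEA]; module
      rw [this, h0, zero_smul])
    obtain ⟨hγ, -⟩ := hindep γ (-α) (by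
      have : γ • S w₀ + (-α) • E = -(α * δ - β * γ) • C := by rw [hT, hEA]; module
      rw [this, h0, neg_zero, zero_smul])
    exact hE0 (by rw [hEA, hγ, hδ, zero_smul, zero_smul, add_zero])
  have hst0 : (0 : ℂ) < t - s := by exact_mod_cast sub_pos.2 hst
  have hslice : ∀ w : n → ℂ,
      S w = (((star w ⬝ᵥ B *ᵥ w) * δ - (star w ⬝ᵥ D *ᵥ w) * γ) / (α * δ - β * γ)) • S w₀ +
        (((star w ⬝ᵥ D *ᵥ w) * α - (star w ⬝ᵥ B *ᵥ w) * β) / (α * δ - β * γ)) • E := by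
    intro w
    rw [hT, hEA]
    ext i j
    simp only [hS, add_apply, smul_apply, smul_eq_mul, div_eq_mul_inv]
    linear_combination (-(star w ⬝ᵥ B *ᵥ w) * A i j - (star w ⬝ᵥ D *ᵥ w) * C i j) *
      mul_inv_cancel₀ hdet
  have hcoeff := fun w => hcone _ _ (hslice w ▸ hSpos w)
  refine ⟨S w₀ + (t : ℂ) • E, S w₀ + (s : ℂ) • E,
    (-β - s * δ) / (α * δ - β * γ) / (t - s), (α + s * γ) / (α * δ - β * γ) / (t - s),
    (t * δ + β) / (α * δ - β * γ) / (t - s), (-t * γ - α) / (α * δ - β * γ) / (t - s), ht, hs,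
    .of_forall_nonneg fun w => ?_, .of_forall_nonneg fun w => ?_, ?_⟩
  · convert div_nonneg (hcoeff w).1 hst0.le using 1
    simp only [add_mulVec, smul_mulVec, dotProduct_add, dotProduct_smul, smul_eq_mul]
    ring
  · convert div_nonneg (hcoeff w).2 hst0.le using 1
    simp only [add_mulVec, smul_mulVec, dotProduct_add, dotProduct_smul, smul_eq_mul]
    ring
  · rw [hT, hEA]
    ext ⟨i, p⟩ ⟨j, q⟩
    have := hst0.ne'
    simp only [add_apply, smul_apply, smul_eq_mul, kroneckerMap_apply]
    field_simp
    ring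

end QuadraticForm

end Matrix

theorem multiKron_cons {N : ℕ} {k : Fin (N + 1) → ℕ}
    (A : (i : Fin (N + 1)) → Matrix (Fin (k i)) (Fin (k i)) ℂ) :
    (multiKron A).submatrix (Fin.consEquiv fun i => Fin (k i)) (Fin.consEquiv fun i => Fin (k i)) =
      A 0 ⊗ₖ multiKron fun i : Fin N => A i.succ := by
  ext ⟨a, p⟩ ⟨b, q⟩
  simp [multiKron, Fin.consEquiv, Fin.prod_univ_succ]

/-- The convex cone of separable matrices. -/
noncomputable def separableCone {N : ℕ} (k : Fin N → ℕ) :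
    AddSubmonoid (Matrix ((i : Fin N) → Fin (k i)) ((i : Fin N) → Fin (k i)) ℂ) :=
  AddSubmonoid.closure {X | ∃ (c : ℂ) (C : (i : Fin N) → Matrix (Fin (k i)) (Fin (k i)) ℂ),
    0 ≤ c ∧ (∀ i, (C i).PosSemidef) ∧ X = c • multiKron C}

theorem kronecker_mem_separableCone {N : ℕ} {k : Fin (N + 1) → ℕ}
    {P : Matrix (Fin (k 0)) (Fin (k 0)) ℂ} (hP : P.PosSemidef)
    {K : Matrix ((i : Fin N) → Fin (k i.succ)) ((i : Fin N) → Fin (k i.succ)) ℂ}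
    (hK : K ∈ separableCone fun i : Fin N => k i.succ) :
    (P ⊗ₖ K).submatrix (Fin.consEquiv fun i => Fin (k i)).symm
      (Fin.consEquiv fun i => Fin (k i)).symm ∈ separableCone k := by
  induction hK using AddSubmonoid.closure_induction with
  | mem X hX =>
    obtain ⟨c, C, hc, hC, rfl⟩ := hX
    refine AddSubmonoid.subset_closure ⟨c, Fin.cons P C, hc, Fin.cases hP hC, ?_⟩
    have h := multiKron_cons (k := k) (Fin.cons P C)
    simp only [Fin.cons_zero, Fin.cons_succ] at h
    rw [kronecker_smul, ← h]
    ext p q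
    simp [Fin.consEquiv]
  | zero => simp
  | add X Y _ _ hX hY =>
    rw [kronecker_add]
    exact add_mem hX hY

theorem mem_separableCone_of_posSemidef {N : ℕ} {k : Fin N → ℕ}
    (A B : (i : Fin N) → Matrix (Fin (k i)) (Fin (k i)) ℂ) (a b : ℂ)
    (h : (a • multiKron A + b • multiKron B).PosSemidef) :
    a • multiKron A + b • multiKron B ∈ separableCone k := by
  induction N generalizing a b with
  | zero =>
    refine AddSubmonoid.subset_closure ⟨a + b, A, ?_, fun i => i.elim0, ?_⟩
    · simpa [multiKron] using h.diag_nonneg (i := fun i => i.elim0)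
    · rw [Subsingleton.elim B A, add_smul]
  | succ N ih =>
    set e := Fin.consEquiv fun i => Fin (k i)
    have he : (a • multiKron A + b • multiKron B).submatrix e e =
        (a • A 0) ⊗ₖ multiKron (fun i : Fin N => A i.succ) +
          (b • B 0) ⊗ₖ multiKron (fun i : Fin N => B i.succ) := by
      rw [smul_kronecker, smul_kronecker, ← multiKron_cons, ← multiKron_cons]
      rfl
    have hs := h.submatrix e
    rw [he] at hs
    obtain ⟨P, Q, x, y, z, w, hP, hQ, hK, hL, hsum⟩ := hs.exists_kronecker_add_kronecker
    have hM : a • multiKron A + b • multiKron B =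
        ((a • multiKron A + b • multiKron B).submatrix e e).submatrix e.symm e.symm := by
      simp
    rw [hM, he, hsum]
    exact add_mem (kronecker_mem_separableCone hP (ih _ _ _ _ hK))
      (kronecker_mem_separableCone hQ (ih _ _ _ _ hL))

theorem exists_smul_multiKron_eq {N : ℕ} {k : Fin (N + 1) → ℕ} {c : ℂ} (hc : 0 ≤ c)
    {C : (i : Fin (N + 1)) → Matrix (Fin (k i)) (Fin (k i)) ℂ} (hC : ∀ i, (C i).PosSemidef) :
    ∃ C' : (i : Fin (N + 1)) → Matrix (Fin (k i)) (Fin (k i)) ℂ,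
      (∀ i, (C' i).PosSemidef) ∧ c • multiKron C = multiKron C' := by
  refine ⟨Fin.cons (c • C 0) fun i => C i.succ, Fin.cases ((hC 0).smul hc) fun i => hC i.succ, ?_⟩
  ext p q
  simp [multiKron, Fin.prod_univ_succ, mul_assoc]

/-- Every positive semidefinite Hermitian matrix in `M_{k₁} ⊗ ⋯ ⊗ M_{k_N}` of tensor
rank at most 2 is separable. -/
theorem stmt19 {N : ℕ} {k : Fin N → ℕ}
    (M : Matrix ((i : Fin N) → Fin (k i)) ((i : Fin N) → Fin (k i)) ℂ)
    (hM : M.PosSemidef)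
    (hrank : ∃ A B : (i : Fin N) → Matrix (Fin (k i)) (Fin (k i)) ℂ,
      M = multiKron A + multiKron B) :
    ∃ (s : ℕ) (C : Fin s → (i : Fin N) → Matrix (Fin (k i)) (Fin (k i)) ℂ),
      (∀ j i, (C j i).PosSemidef) ∧ M = ∑ j, multiKron (C j) := by
  obtain ⟨A, B, rfl⟩ := hrank
  cases N with
  | zero => exact ⟨2, ![A, B], fun _ i => i.elim0, by simp⟩
  | succ N =>
    have hmem := mem_separableCone_of_posSemidef A B 1 1 (by simpa using hM)
    rw [one_smul, one_smul] at hmem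
    obtain ⟨l, hl, hsum⟩ := AddSubmonoid.exists_list_of_mem_closure hmem
    have hC : ∀ j : Fin l.length, ∃ C : (i : Fin (N + 1)) → Matrix (Fin (k i)) (Fin (k i)) ℂ,
        (∀ i, (C i).PosSemidef) ∧ l[j] = multiKron C := by
      intro j
      obtain ⟨c, C, hc, hC, hj⟩ := hl l[j] (List.getElem_mem _)
      rw [hj]
      exact exists_smul_multiKron_eq hc hC
    choose C hC hlC using hC
    refine ⟨l.length, C, hC, ?_⟩
    rw [← hsum, ← Fin.sum_univ_getElem]
    exact Finset.sum_congr rfl fun j _ => hlC j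
end
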